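/- arXiv:2210.04768 — 3 statements merged into one kernel-verified Lean document; each statement's English description precedes it below -/
import Mathlib

section
/- For n = 7 and any c with 3 ≤ c ≤ 7, the friends-and-strangers graph FS(Spider(2,2,1,1), complement of Tad_{c,7−c}) is connected. -/
open SimpleGraph

/-- The friends-and-strangers graph of `X` and `Y`: vertices are bijections `σ : V ≃ W`,
and `σ, φ` are adjacent iff there is an edge `{a,b}` of `X` with `{σ a, σ b}` an edge of `Y`
such that `φ` is obtained from `σ` by swapping the values at `a` and `b`. -/
def FS {V W : Type*} [DecidableEq V] (X : SimpleGraph V) (Y : SimpleGraph W) : SimpleGraph (V ≃ W) :=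
  SimpleGraph.fromRel (fun σ φ =>
    ∃ a b : V, X.Adj a b ∧ Y.Adj (σ a) (σ b) ∧ φ = (Equiv.swap a b).trans σ)

/-- `m` is the first vertex (0-indexed) of one of the legs of the spider with leg
lengths `L`, i.e. `m` is the sum of a proper prefix of `L`. -/
def legStart (L : List ℕ) (m : ℕ) : Prop :=
  ∃ t : List ℕ, t <+: L ∧ t ≠ L ∧ t.sum = m

/-- The spider graph on `Fin n` (intended for `n = L.sum + 1`) with leg lengths given by the
list `L`: vertex `n-1` is the center, and the legs occupy consecutive blocks of vertices. -/
def Spider (n : ℕ) (L : List ℕ) : SimpleGraph (Fin n) :=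
  SimpleGraph.fromRel (fun i j =>
    ((j : ℕ) = n - 1 ∧ legStart L (i : ℕ)) ∨
    ((j : ℕ) = (i : ℕ) + 1 ∧ ¬ legStart L ((i : ℕ) + 1) ∧ (i : ℕ) + 1 < n - 1))

/-- The tadpole graph on `Fin n`: a cycle on vertices `0, …, c-1` together with the
path `c-1, c, …, n-1` (0-indexed version of: edges `{k,k+1}` plus `{1,c}`). -/
def Tadpole (n c : ℕ) : SimpleGraph (Fin n) :=
  SimpleGraph.fromRel (fun i j =>
    (j : ℕ) = (i : ℕ) + 1 ∨ ((i : ℕ) = 0 ∧ (j : ℕ) = c - 1))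

/-- The path graph on `n` vertices. -/
def PathG (n : ℕ) : SimpleGraph (Fin n) :=
  SimpleGraph.fromRel (fun i j => (j : ℕ) = (i : ℕ) + 1)

/-- The cycle graph on `n` vertices. -/
def CycleG (n : ℕ) : SimpleGraph (Fin n) :=
  SimpleGraph.fromRel (fun i j =>
    (j : ℕ) = (i : ℕ) + 1 ∨ ((i : ℕ) = 0 ∧ (j : ℕ) = n - 1))

namespace SpiderTadpole

/-- The values of a permutation of `Fin 7`, listed in order of position. -/
def values (σ : Fin 7 ≃ Fin 7) : List ℕ :=
  [σ 0, σ 1, σ 2, σ 3, σ 4, σ 5, σ 6]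

/-- Boolean test for adjacency in the complement of the tadpole graph. -/
def friends (c x y : ℕ) : Bool :=
  !(x.beq y || y.beq (x + 1) || x.beq (y + 1) ||
    (x.beq 0 && y.beq (c - 1)) || (y.beq 0 && x.beq (c - 1)))

/-- Put `x` in front of the list `l` if `b` is true. -/
def consIf {α : Type*} (b : Bool) (x : α) (l : List α) : List α :=
  bif b then x :: l else l

/-- The lists obtained by one friendly swap along an edge of `Spider(2,2,1,1)`. -/
def moves (c : ℕ) : List ℕ → List (List ℕ)
  | [x₀, x₁, x₂, x₃, x₄, x₅, x₆] =>
    consIf (friends c x₀ x₆) [x₆, x₁, x₂, x₃, x₄, x₅, x₀] <|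
    consIf (friends c x₂ x₆) [x₀, x₁, x₆, x₃, x₄, x₅, x₂] <|
    consIf (friends c x₄ x₆) [x₀, x₁, x₂, x₃, x₆, x₅, x₄] <|
    consIf (friends c x₅ x₆) [x₀, x₁, x₂, x₃, x₄, x₆, x₅] <|
    consIf (friends c x₀ x₁) [x₁, x₀, x₂, x₃, x₄, x₅, x₆] <|
    consIf (friends c x₂ x₃) [x₀, x₁, x₃, x₂, x₄, x₅, x₆] []
  | _ => []

/-- The number whose decimal digits are the labels of the entries of the list at the positions
`3, 1, 2, 0, 6, 4, 5`, where the label of `x` is the digit of `lab` of weight `10 ^ x`. -/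
def rank (lab : ℕ) : List ℕ → ℕ
  | [x₀, x₁, x₂, x₃, x₄, x₅, x₆] =>
    [x₃, x₁, x₂, x₀, x₆, x₄, x₅].foldl (fun r x => 10 * r + lab / 10 ^ x % 10) 0
  | _ => 0

/-- Some list reachable from `F` by at least one and at most `k` moves satisfies `p`. -/
def search (c : ℕ) (p : List ℕ → Bool) : ℕ → List (List ℕ) → Bool
  | 0, _ => false
  | k + 1, F => (F.flatMap (moves c)).any p || search c p k (F.flatMap (moves c))

/-- Every arrangement other than `root` can lower its rank within `6` moves. -/
def descends (c : ℕ) (lab : ℕ) (root : List ℕ) : Bool :=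
  (List.permutations' [0, 1, 2, 3, 4, 5, 6]).all fun l =>
    l == root || search c (fun l' => (rank lab l').blt (rank lab l)) 6 [l]

theorem mem_consIf {α : Type*} {b : Bool} {x y : α} {l : List α} :
    y ∈ consIf b x l ↔ b = true ∧ y = x ∨ y ∈ l := by
  cases b <;> simp [consIf]

theorem legStart_iff (m : ℕ) : legStart [2, 2, 1, 1] m ↔ m ∈ [0, 2, 4, 5] := by
  have h : legStart [2, 2, 1, 1] m ↔
      ∃ t ∈ [[], [2], [2, 2], [2, 2, 1], [2, 2, 1, 1]], t ≠ [2, 2, 1, 1] ∧ t.sum = m := by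
    simp only [legStart, ← List.mem_inits]
    rfl
  rw [h]
  constructor
  · rintro ⟨t, ht, hne, rfl⟩
    fin_cases ht <;> simp at hne ⊢
  · intro hm
    fin_cases hm
    · exact ⟨[], by decide⟩
    · exact ⟨[2], by decide⟩
    · exact ⟨[2, 2], by decide⟩
    · exact ⟨[2, 2, 1], by decide⟩

theorem spider_adj : (Spider 7 [2, 2, 1, 1]).Adj 0 6 ∧ (Spider 7 [2, 2, 1, 1]).Adj 2 6 ∧
    (Spider 7 [2, 2, 1, 1]).Adj 4 6 ∧ (Spider 7 [2, 2, 1, 1]).Adj 5 6 ∧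
    (Spider 7 [2, 2, 1, 1]).Adj 0 1 ∧ (Spider 7 [2, 2, 1, 1]).Adj 2 3 := by
  simp [Spider, legStart_iff]

theorem compl_tadpole_adj {c : ℕ} {x y : Fin 7} (h : friends c x y) :
    (Tadpole 7 c)ᶜ.Adj x y := by
  rw [friends, Bool.not_eq_true', ← Bool.not_eq_true] at h
  simp only [Bool.or_eq_true, Bool.and_eq_true, Nat.beq_eq] at h
  simp only [compl_adj, Tadpole, fromRel_adj, ne_eq, Fin.ext_iff]
  lia

theorem adj_swap {c : ℕ} {σ : Fin 7 ≃ Fin 7} {a b : Fin 7}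
    (hab : (Spider 7 [2, 2, 1, 1]).Adj a b) (h : friends c (σ a) (σ b)) :
    (FS (Spider 7 [2, 2, 1, 1]) (Tadpole 7 c)ᶜ).Adj σ ((Equiv.swap a b).trans σ) := by
  rw [FS, fromRel_adj]
  refine ⟨fun e => hab.ne ?_, .inl ⟨a, b, hab, compl_tadpole_adj h, rfl⟩⟩
  simpa using (DFunLike.congr_fun e b).symm

theorem exists_adj_of_mem_moves {c : ℕ} {σ : Fin 7 ≃ Fin 7} {l : List ℕ}
    (h : l ∈ moves c (values σ)) :
    ∃ τ, (FS (Spider 7 [2, 2, 1, 1]) (Tadpole 7 c)ᶜ).Adj σ τ ∧ values τ = l := by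
  obtain ⟨h₁, h₂, h₃, h₄, h₅, h₆⟩ := spider_adj
  simp only [moves, values, mem_consIf, List.not_mem_nil, or_false] at h
  rcases h with ⟨h, rfl⟩ | ⟨h, rfl⟩ | ⟨h, rfl⟩ | ⟨h, rfl⟩ | ⟨h, rfl⟩ | ⟨h, rfl⟩
  · exact ⟨_, adj_swap h₁ h, rfl⟩
  · exact ⟨_, adj_swap h₂ h, rfl⟩
  · exact ⟨_, adj_swap h₃ h, rfl⟩
  · exact ⟨_, adj_swap h₄ h, rfl⟩
  · exact ⟨_, adj_swap h₅ h, rfl⟩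
  · exact ⟨_, adj_swap h₆ h, rfl⟩

theorem exists_reachable_of_search {c : ℕ} {p : List ℕ → Bool} {σ : Fin 7 ≃ Fin 7} {k : ℕ}
    {F : List (List ℕ)}
    (hF : ∀ l ∈ F, ∃ τ, (FS (Spider 7 [2, 2, 1, 1]) (Tadpole 7 c)ᶜ).Reachable σ τ ∧ values τ = l)
    (h : search c p k F) :
    ∃ τ, (FS (Spider 7 [2, 2, 1, 1]) (Tadpole 7 c)ᶜ).Reachable σ τ ∧ p (values τ) := by
  induction k generalizing F with
  | zero => simp [search] at h
  | succ k ih =>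
    have hF' : ∀ l ∈ F.flatMap (moves c),
        ∃ τ, (FS (Spider 7 [2, 2, 1, 1]) (Tadpole 7 c)ᶜ).Reachable σ τ ∧ values τ = l := by
      intro l hl
      obtain ⟨l₀, hl₀, hl⟩ := List.mem_flatMap.1 hl
      obtain ⟨τ₀, hτ₀, rfl⟩ := hF l₀ hl₀
      obtain ⟨τ, hτ, rfl⟩ := exists_adj_of_mem_moves hl
      exact ⟨τ, hτ₀.trans hτ.reachable, rfl⟩
    rw [search, Bool.or_eq_true] at h
    rcases h with h | h
    · obtain ⟨l, hl, hp⟩ := List.any_eq_true.1 h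
      obtain ⟨τ, hτ, rfl⟩ := hF' l hl
      exact ⟨τ, hτ, hp⟩
    · exact ih hF' h

theorem values_mem_permutations' (σ : Fin 7 ≃ Fin 7) :
    values σ ∈ List.permutations' [0, 1, 2, 3, 4, 5, 6] := by
  have h : (List.ofFn σ).Perm (List.ofFn id) := Equiv.Perm.ofFn_comp_perm σ id
  exact List.mem_permutations'.2 (h.map Fin.val)

theorem values_injective : Function.Injective values := by
  intro σ τ h
  simp only [values, List.cons.injEq, Fin.val_inj, and_true] at h
  ext i
  fin_cases i <;> simp [h]

theorem exists_reachable_values_eq {c : ℕ} {lab : ℕ} {root : List ℕ}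
    (h : descends c lab root) (σ : Fin 7 ≃ Fin 7) :
    ∃ τ, (FS (Spider 7 [2, 2, 1, 1]) (Tadpole 7 c)ᶜ).Reachable σ τ ∧ values τ = root := by
  induction hr : rank lab (values σ) using Nat.strong_induction_on generalizing σ with
  | _ r ih =>
    have hσ := List.all_eq_true.1 h _ (values_mem_permutations' σ)
    rw [Bool.or_eq_true, beq_iff_eq] at hσ
    rcases hσ with hσ | hσ
    · exact ⟨σ, .rfl, hσ⟩
    · have hF : ∀ l ∈ [values σ], ∃ τ,
          (FS (Spider 7 [2, 2, 1, 1]) (Tadpole 7 c)ᶜ).Reachable σ τ ∧ values τ = l :=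
        fun l hl => ⟨σ, .rfl, (List.mem_singleton.1 hl).symm⟩
      obtain ⟨τ, hτ, hlt⟩ := exists_reachable_of_search hF hσ
      rw [Nat.blt_eq, hr] at hlt
      obtain ⟨ρ, hρ, hroot⟩ := ih _ hlt τ rfl
      exact ⟨ρ, hτ.trans hρ, hroot⟩

theorem connected_of_descends {c : ℕ} {lab : ℕ} {root : List ℕ} (h : descends c lab root) :
    (FS (Spider 7 [2, 2, 1, 1]) (Tadpole 7 c)ᶜ).Connected := by
  refine connected_iff _ |>.2 ⟨fun σ τ => ?_, ⟨Equiv.refl _⟩⟩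
  obtain ⟨ρ, hρ, hρ_root⟩ := exists_reachable_values_eq h σ
  obtain ⟨ρ', hρ', hρ_root'⟩ := exists_reachable_values_eq h τ
  obtain rfl := values_injective (hρ_root.trans hρ_root'.symm)
  exact hρ.trans hρ'.symm

theorem descends_three : descends 3 3260541 [6, 0, 5, 3, 2, 4, 1] := by
  decide +kernel

theorem descends_four : descends 4 4615230 [1, 4, 2, 0, 3, 5, 6] := by
  decide +kernel

theorem descends_five : descends 5 4153260 [3, 5, 2, 0, 4, 1, 6] := by
  decide +kernel

theorem descends_six : descends 6 3516240 [6, 4, 2, 0, 5, 3, 1] := by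
  decide +kernel

theorem descends_seven : descends 7 6235140 [4, 2, 5, 0, 3, 6, 1] := by
  decide +kernel

end SpiderTadpole

/-- For every `3 ≤ c ≤ 7`, the graph `FS(Spider(2,2,1,1), complement of Tad_{c,7-c})`
is connected. -/
theorem stmt5 (c : ℕ) (h1 : 3 ≤ c) (h2 : c ≤ 7) :
    (FS (Spider 7 [2,2,1,1]) (Tadpole 7 c)ᶜ).Connected := by
  interval_cases c
  · exact SpiderTadpole.connected_of_descends SpiderTadpole.descends_three
  · exact SpiderTadpole.connected_of_descends SpiderTadpole.descends_four
  · exact SpiderTadpole.connected_of_descends SpiderTadpole.descends_five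
  · exact SpiderTadpole.connected_of_descends SpiderTadpole.descends_six
  · exact SpiderTadpole.connected_of_descends SpiderTadpole.descends_seven
end

section
/- Let a ≥ b ≥ 2 be integers and n = a + b + 3. For every c with 3 ≤ c ≤ n, the friends-and-strangers graph FS(Spider(a,b,1,1), complement of Tad_{c,n−c}) is connected. -/
open SimpleGraph

namespace FS

section General

variable {V W V' W' : Type*} [DecidableEq V] [DecidableEq V']
  {X : SimpleGraph V} {Y : SimpleGraph W} {X' : SimpleGraph V'} {Y' : SimpleGraph W'}

lemma adj_swap {σ : V ≃ W} {a b : V} (hX : X.Adj a b) (hY : Y.Adj (σ a) (σ b)) :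
    (FS X Y).Adj σ ((Equiv.swap a b).trans σ) := by
  refine (SimpleGraph.fromRel_adj _ _ _).2 ⟨fun h => ?_, Or.inl ⟨a, b, hX, hY, rfl⟩⟩
  have h' := congrArg (fun τ : V ≃ W => τ a) h
  simp only [Equiv.trans_apply, Equiv.swap_apply_left] at h'
  exact hY.ne h'

lemma adj_iff {σ φ : V ≃ W} :
    (FS X Y).Adj σ φ ↔
      ∃ a b, X.Adj a b ∧ Y.Adj (σ a) (σ b) ∧ φ = (Equiv.swap a b).trans σ := by
  constructor
  · intro h
    obtain ⟨-, h | ⟨a, b, hX, hY, rfl⟩⟩ := (SimpleGraph.fromRel_adj _ _ _).1 h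
    · exact h
    · refine ⟨a, b, hX, by simpa using hY.symm, ?_⟩
      ext x
      simp
  · rintro ⟨a, b, hX, hY, rfl⟩
    exact adj_swap hX hY

/-- A map between sets of arrangements which is compatible with maps of positions and of people
preserves reachability. -/
lemma reachable_map {f : V' → V} {g : W' → W} (F : (V' ≃ W') → (V ≃ W))
    (hf : ∀ i j, X'.Adj i j → X.Adj (f i) (f j)) (hg : ∀ i j, Y'.Adj i j → Y.Adj (g i) (g j))
    (hF : ∀ τ i, F τ (f i) = g (τ i))
    (hswap : ∀ τ i j, F ((Equiv.swap i j).trans τ) = (Equiv.swap (f i) (f j)).trans (F τ))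
    {τ φ : V' ≃ W'} (h : (FS X' Y').Reachable τ φ) : (FS X Y).Reachable (F τ) (F φ) := by
  refine h.map (⟨F, fun {τ φ} h => ?_⟩ : FS X' Y' →g FS X Y)
  obtain ⟨i, j, hX, hY, rfl⟩ := adj_iff.1 h
  rw [hswap]
  exact adj_swap (hf _ _ hX) (by simpa only [hF] using hg _ _ hY)

lemma connected_of_equiv (p : V' ≃ V) (q : W' ≃ W) (hp : ∀ i j, X'.Adj i j → X.Adj (p i) (p j))
    (hq : ∀ i j, Y'.Adj i j → Y.Adj (q i) (q j)) (h : (FS X' Y').Connected) :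
    (FS X Y).Connected := by
  let F : (V' ≃ W') → (V ≃ W) := fun τ => p.symm.trans (τ.trans q)
  have hsurj : ∀ σ, F (p.trans (σ.trans q.symm)) = σ := fun σ => by ext x; simp [F]
  have hne : Nonempty (V ≃ W) := h.nonempty.map F
  refine SimpleGraph.Connected.mk fun σ φ => ?_
  rw [← hsurj σ, ← hsurj φ]
  refine reachable_map (f := p) (g := q) F hp hq (fun τ i => by simp [F]) (fun τ i j => ?_)
    (h.preconnected _ _)
  ext x
  simp only [F, Equiv.trans_apply, Equiv.swap_apply_def, Equiv.symm_apply_eq]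
  split_ifs <;> simp_all

end General

/-- Extend an arrangement by a new person `v` at a new position `l`. -/
def extend {n : ℕ} (l v : Fin (n + 1)) (τ : Fin n ≃ Fin n) : Fin (n + 1) ≃ Fin (n + 1) :=
  (finSuccEquiv' l).trans ((Equiv.optionCongr τ).trans (finSuccEquiv' v).symm)

lemma extend_self {n : ℕ} (l v : Fin (n + 1)) (τ : Fin n ≃ Fin n) : extend l v τ l = v := by
  simp [extend]

lemma extend_succAbove {n : ℕ} (l v : Fin (n + 1)) (τ : Fin n ≃ Fin n) (i : Fin n) :
    extend l v τ (l.succAbove i) = v.succAbove (τ i) := by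
  simp [extend]

lemma exists_extend_eq {n : ℕ} {l v : Fin (n + 1)} {σ : Fin (n + 1) ≃ Fin (n + 1)}
    (h : σ l = v) : ∃ τ, extend l v τ = σ := by
  have hne : ∀ i, σ (l.succAbove i) ≠ v := fun i hi =>
    l.succAbove_ne i (σ.injective (hi.trans h.symm))
  choose g hg using fun i => Fin.exists_succAbove_eq (hne i)
  have hinj : Function.Injective g := fun i j hij =>
    l.succAbove_right_injective (σ.injective (by rw [← hg, ← hg, hij]))
  refine ⟨Equiv.ofBijective g (Finite.injective_iff_bijective.1 hinj), Equiv.ext fun x => ?_⟩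
  rcases Fin.eq_self_or_eq_succAbove l x with rfl | ⟨i, rfl⟩
  · rw [extend_self, h]
  · rw [extend_succAbove, Equiv.ofBijective_apply, hg]

lemma extend_swap {n : ℕ} (l v : Fin (n + 1)) (τ : Fin n ≃ Fin n) (i j : Fin n) :
    extend l v ((Equiv.swap i j).trans τ) =
      (Equiv.swap (l.succAbove i) (l.succAbove j)).trans (extend l v τ) := by
  refine Equiv.ext fun x => ?_
  rcases Fin.eq_self_or_eq_succAbove l x with rfl | ⟨k, rfl⟩
  · rw [extend_self, Equiv.trans_apply, Equiv.swap_apply_of_ne_of_ne (Fin.succAbove_ne _ _).symm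
      (Fin.succAbove_ne _ _).symm, extend_self]
  · rw [extend_succAbove, Equiv.trans_apply, Equiv.trans_apply,
      ← l.succAbove_right_injective.map_swap, extend_succAbove]

/-- If deleting the position `l` always leaves a connected friends-and-strangers graph, whoever is
removed along with it, then the whole graph is connected. -/
lemma connected_of_succAbove {n : ℕ} {X Y : SimpleGraph (Fin (n + 1))} {X' : SimpleGraph (Fin n)}
    {l m : Fin (n + 1)} (hlm : X.Adj l m)
    (hX : ∀ i j, X'.Adj i j → X.Adj (l.succAbove i) (l.succAbove j)) (hY : Y.Connected)
    (h : ∀ v : Fin (n + 1), ∃ Y' : SimpleGraph (Fin n),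
      (∀ i j, Y'.Adj i j → Y.Adj (v.succAbove i) (v.succAbove j)) ∧ (FS X' Y').Connected) :
    (FS X Y).Connected := by
  have same : ∀ v σ φ, σ l = v → φ l = v → (FS X Y).Reachable σ φ := by
    intro v σ φ hσ hφ
    obtain ⟨Y', hY', hc⟩ := h v
    obtain ⟨σ, rfl⟩ := exists_extend_eq hσ
    obtain ⟨φ, rfl⟩ := exists_extend_eq hφ
    exact reachable_map (extend l v) hX hY' (extend_succAbove l v) (extend_swap l v)
      (hc.preconnected _ _)
  have link : ∀ v w, Y.Reachable v w → ∀ σ φ, σ l = v → φ l = w → (FS X Y).Reachable σ φ := by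
    intro v w hvw
    rw [SimpleGraph.reachable_iff_reflTransGen] at hvw
    induction hvw with
    | refl => exact same v
    | @tail u w _ huw ih =>
      intro σ φ hσ hφ
      obtain ⟨ψ, hψl, hψm⟩ : ∃ ψ : Fin (n + 1) ≃ Fin (n + 1), ψ l = u ∧ ψ m = w := by
        refine ⟨(Equiv.swap l u).trans (Equiv.swap (Equiv.swap l u m) w), ?_, ?_⟩
        · rw [Equiv.trans_apply, Equiv.swap_apply_left]
          refine Equiv.swap_apply_of_ne_of_ne (fun hu => ?_) huw.ne
          exact hlm.ne ((Equiv.swap l u).injective (by rw [Equiv.swap_apply_left, ← hu]))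
        · rw [Equiv.trans_apply, Equiv.swap_apply_left]
      have hadj := adj_swap (X := X) (Y := Y) (σ := ψ) hlm (by rwa [hψl, hψm])
      exact (ih σ ψ hσ hψl).trans (hadj.reachable.trans (same w _ _ (by simp [hψm]) hφ))
  have : Nonempty (Fin (n + 1) ≃ Fin (n + 1)) := ⟨Equiv.refl _⟩
  exact SimpleGraph.Connected.mk fun σ φ => link _ _ (hY.preconnected _ _) σ φ rfl rfl

end FS

lemma legStart_iff {a b m : ℕ} :
    legStart [a, b, 1, 1] m ↔ m = 0 ∨ m = a ∨ m = a + b ∨ m = a + b + 1 := by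
  constructor
  · rintro ⟨t, ht, hne, rfl⟩
    simp only [List.prefix_cons_iff, List.prefix_nil] at ht
    rcases ht with rfl | ⟨_, rfl, rfl | ⟨_, rfl, rfl | ⟨_, rfl, rfl | ⟨_, rfl, rfl⟩⟩⟩⟩ <;>
      simp_all [add_assoc]
  · rintro (rfl | rfl | rfl | rfl)
    · exact ⟨[], by simp, by simp, by simp⟩
    · exact ⟨[m], by simp, by simp, by simp⟩
    · exact ⟨[a, b], by simp, by simp, by simp⟩
    · exact ⟨[a, b, 1], by simp, by simp, by simp [add_assoc]⟩

lemma Tadpole_compl_adj {n c : ℕ} {i j : Fin n} :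
    (Tadpole n c)ᶜ.Adj i j ↔ (i : ℕ) ≠ j ∧ (j : ℕ) ≠ i + 1 ∧ (i : ℕ) ≠ j + 1 ∧
      ¬((i : ℕ) = 0 ∧ (j : ℕ) = c - 1) ∧ ¬((j : ℕ) = 0 ∧ (i : ℕ) = c - 1) := by
  rw [SimpleGraph.compl_adj, Tadpole, SimpleGraph.fromRel_adj, ne_eq, Fin.ext_iff]
  tauto

lemma Tadpole_compl_connected {n c : ℕ} (hn : 7 ≤ n) : (Tadpole n c)ᶜ.Connected := by
  have consec : ∀ k (hk : k + 1 < n),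
      (Tadpole n c)ᶜ.Reachable ⟨k, by omega⟩ ⟨k + 1, hk⟩ := by
    intro k hk
    obtain ⟨x, hx, hx'⟩ : ∃ x ∈ Finset.range n, x ∉ ({k - 1, k, k + 1, k + 2, 0, c - 1} : Finset ℕ) :=
      Finset.exists_mem_notMem_of_card_lt_card
        (Finset.card_le_six.trans_lt (by rw [Finset.card_range]; omega))
    simp only [Finset.mem_range, Finset.mem_insert, Finset.mem_singleton, not_or] at hx hx'
    have h₁ : (Tadpole n c)ᶜ.Adj ⟨k, by omega⟩ ⟨x, hx⟩ := by
      rw [Tadpole_compl_adj]; dsimp only; omega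
    have h₂ : (Tadpole n c)ᶜ.Adj ⟨x, hx⟩ ⟨k + 1, hk⟩ := by
      rw [Tadpole_compl_adj]; dsimp only; omega
    exact h₁.reachable.trans h₂.reachable
  have zero : ∀ k (hk : k < n), (Tadpole n c)ᶜ.Reachable ⟨0, by omega⟩ ⟨k, hk⟩ := by
    intro k
    induction k with
    | zero => exact fun _ => SimpleGraph.Reachable.refl _
    | succ k ih => exact fun hk => (ih (by omega)).trans (consec k hk)
  have : Nonempty (Fin n) := ⟨⟨0, by omega⟩⟩
  exact SimpleGraph.Connected.mk fun v w => (zero v v.2).symm.trans (zero w w.2)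

lemma Tadpole_compl_succAbove {n c : ℕ} (hn : 3 ≤ n) (h3 : 3 ≤ c) (hc : c ≤ n + 1)
    (v : Fin (n + 1)) : ∃ c', 3 ≤ c' ∧ c' ≤ n ∧ ∀ i j : Fin n,
      (Tadpole n c')ᶜ.Adj i j → (Tadpole (n + 1) c)ᶜ.Adj (v.succAbove i) (v.succAbove j) := by
  refine ⟨if (v : ℕ) < c then max 3 (c - 1) else c, by split_ifs <;> omega,
    by split_ifs <;> omega, fun i j => ?_⟩
  rw [Tadpole_compl_adj, Tadpole_compl_adj]
  simp only [Fin.succAbove, Fin.lt_def, Fin.val_castSucc]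
  split_ifs <;> simp only [Fin.val_castSucc, Fin.val_succ] <;> omega

lemma Spider_adj {n a b : ℕ} {i j : Fin n} : (Spider n [a, b, 1, 1]).Adj i j ↔ (i : ℕ) ≠ j ∧
    ((((j : ℕ) = n - 1 ∧ ((i : ℕ) = 0 ∨ (i : ℕ) = a ∨ (i : ℕ) = a + b ∨ (i : ℕ) = a + b + 1)) ∨
      ((j : ℕ) = i + 1 ∧ ¬((i : ℕ) + 1 = a ∨ (i : ℕ) + 1 = a + b ∨
        (i : ℕ) + 1 = a + b + 1) ∧ (i : ℕ) + 1 < n - 1)) ∨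
     (((i : ℕ) = n - 1 ∧ ((j : ℕ) = 0 ∨ (j : ℕ) = a ∨ (j : ℕ) = a + b ∨ (j : ℕ) = a + b + 1)) ∨
      ((i : ℕ) = j + 1 ∧ ¬((j : ℕ) + 1 = a ∨ (j : ℕ) + 1 = a + b ∨
        (j : ℕ) + 1 = a + b + 1) ∧ (j : ℕ) + 1 < n - 1))) := by
  rw [Spider, SimpleGraph.fromRel_adj, ne_eq, Fin.ext_iff, legStart_iff, legStart_iff,
    legStart_iff, legStart_iff]
  simp only [Nat.add_one_ne_zero, false_or]

lemma Spider_succAbove_first {n a b : ℕ} (ha : 1 ≤ a) (hb : 1 ≤ b) (hn : n = a + b + 3)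
    (l : Fin (n + 1)) (hl : (l : ℕ) = a) (i j : Fin n) (h : (Spider n [a, b, 1, 1]).Adj i j) :
    (Spider (n + 1) [a + 1, b, 1, 1]).Adj (l.succAbove i) (l.succAbove j) := by
  rw [Spider_adj] at h ⊢
  simp only [Fin.succAbove, Fin.lt_def, Fin.val_castSucc, hl]
  split_ifs <;> simp only [Fin.val_castSucc, Fin.val_succ] <;> omega

lemma Spider_succAbove_second {n a b : ℕ} (hb : 1 ≤ b) (hn : n = a + b + 3)
    (l : Fin (n + 1)) (hl : (l : ℕ) = a + b) (i j : Fin n)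
    (h : (Spider n [a, b, 1, 1]).Adj i j) :
    (Spider (n + 1) [a, b + 1, 1, 1]).Adj (l.succAbove i) (l.succAbove j) := by
  rw [Spider_adj] at h ⊢
  simp only [Fin.succAbove, Fin.lt_def, Fin.val_castSucc, hl]
  split_ifs <;> simp only [Fin.val_castSucc, Fin.val_succ] <;> omega

namespace FS

/-!
### Arrangements of seven people

An arrangement `σ` of `Fin 7` is encoded by the number with base-eight digits `σ i`. For a fixed
graph of positions, a bounded search over legal swaps shows that every arrangement other than the
one of least code reaches an arrangement of smaller code.
-/

/-- Equal to `f n`; the kernel reduces `n` to a literal before passing it to `f`. -/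
def forceNat {α : Type} (n : ℕ) (f : ℕ → α) : α :=
  Nat.rec (f 0) (fun k _ => f k.succ) n

lemma forceNat_eq {α : Type} (n : ℕ) (f : ℕ → α) : forceNat n f = f n := by
  cases n <;> rfl

/-- The edges of a copy of the spider with legs `2, 2, 1, 1`. -/
def spiderEdges : List (Fin 7 × Fin 7) := [(3, 2), (3, 6), (4, 2), (4, 5), (1, 2), (0, 2)]

/-- The place values of the positions in `spiderEdges`. -/
def edgeWeights : List (ℕ × ℕ) :=
  [(512, 64), (512, 262144), (4096, 64), (4096, 32768), (8, 64), (1, 64)]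

/-- Whether a number below `bound` can be obtained from `s` by at most `d` swaps of digits which
are not excluded by the bit mask `enemy`. -/
def descend (enemy bound : ℕ) : ℕ → ℕ → Bool
  | 0, s => Nat.blt s bound
  | d + 1, s => Nat.blt s bound || edgeWeights.any fun w =>
      forceNat (s / w.1 % 8) fun x => forceNat (s / w.2 % 8) fun y =>
        !(enemy.testBit (8 * x + y)) &&
          forceNat (s + y * w.1 + x * w.2 - x * w.1 - y * w.2) (descend enemy bound d)

/-- Whether `P` holds for all numbers obtained from `s` by appending `k` distinct base-eight digits
from the list `l`. -/
def allDigits (P : ℕ → Bool) : ℕ → List ℕ → ℕ → Bool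
  | 0, _, s => P s
  | k + 1, l, s => l.all fun x => forceNat (8 * s + x) (allDigits P k (l.erase x))

/-- The octal number `0123456`, the least code of an arrangement. -/
def leastCode : ℕ := 42798

/-- Whether every arrangement other than the one of least code reaches one of smaller code by a
short sequence of swaps allowed by `enemy`. -/
def check (enemy : ℕ) : Bool :=
  allDigits (fun s => Nat.beq s leastCode || [1, 3, 5, 7].any fun d => descend enemy s d s)
    7 [0, 1, 2, 3, 4, 5, 6] 0

lemma apply_of_allDigits {P : ℕ → Bool} {t l : List ℕ} {s : ℕ} (htl : t.Perm l)
    (h : allDigits P t.length l s = true) : P (t.foldl (fun r x => 8 * r + x) s) = true := by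
  induction t generalizing l s with
  | nil => exact h
  | cons x t ih =>
    obtain ⟨hx, ht⟩ := List.cons_perm_iff_perm_erase.1 htl
    simp only [List.length_cons, allDigits, List.all_eq_true, forceNat_eq] at h
    exact ih ht (h x hx)

/-- The number with base-eight digits `σ i`. -/
def code (σ : Fin 7 ≃ Fin 7) : ℕ :=
  σ 0 + 8 * σ 1 + 64 * σ 2 + 512 * σ 3 + 4096 * σ 4 + 32768 * σ 5 + 262144 * σ 6

lemma code_injective : Function.Injective code := by
  intro σ τ h
  unfold code at h
  refine Equiv.ext fun i => Fin.ext ?_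
  fin_cases i <;> dsimp <;> omega

lemma check_apply {enemy : ℕ} (h : check enemy = true) (σ : Fin 7 ≃ Fin 7) :
    code σ = leastCode ∨ ∃ d, descend enemy (code σ) d (code σ) = true := by
  have hperm : [(σ 6 : ℕ), σ 5, σ 4, σ 3, σ 2, σ 1, σ 0].Perm [0, 1, 2, 3, 4, 5, 6] :=
    (List.reverse_perm _).symm.trans ((Equiv.Perm.map_finRange_perm σ).map Fin.val)
  have := apply_of_allDigits hperm h
  have hcode : [(σ 6 : ℕ), σ 5, σ 4, σ 3, σ 2, σ 1, σ 0].foldl (fun r x => 8 * r + x) 0 =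
      code σ := by
    simp only [List.foldl, code]
    ring
  rw [hcode, Bool.or_eq_true, List.any_eq_true] at this
  obtain h | ⟨d, -, h⟩ := this
  · exact Or.inl (Nat.eq_of_beq_eq_true h)
  · exact Or.inr ⟨d, h⟩

lemma code_swap {w : ℕ × ℕ} (hw : w ∈ edgeWeights) : ∃ e ∈ spiderEdges, ∀ σ : Fin 7 ≃ Fin 7,
    code σ / w.1 % 8 = σ e.1 ∧ code σ / w.2 % 8 = σ e.2 ∧
      code σ + σ e.2 * w.1 + σ e.1 * w.2 - σ e.1 * w.1 - σ e.2 * w.2 =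
        code ((Equiv.swap e.1 e.2).trans σ) := by
  have key : ∀ e ∈ spiderEdges, ∀ σ : Fin 7 ≃ Fin 7,
      code σ / 8 ^ (e.1 : ℕ) % 8 = σ e.1 ∧ code σ / 8 ^ (e.2 : ℕ) % 8 = σ e.2 ∧
      code σ + σ e.2 * 8 ^ (e.1 : ℕ) + σ e.1 * 8 ^ (e.2 : ℕ) - σ e.1 * 8 ^ (e.1 : ℕ) -
        σ e.2 * 8 ^ (e.2 : ℕ) = code ((Equiv.swap e.1 e.2).trans σ) := by
    intro e he σ
    simp only [spiderEdges, List.mem_cons, List.not_mem_nil, or_false] at he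
    unfold code
    rcases he with rfl | rfl | rfl | rfl | rfl | rfl <;>
      simp [Equiv.swap_apply_def] <;> omega
  have hmap : edgeWeights = spiderEdges.map fun e => (8 ^ (e.1 : ℕ), 8 ^ (e.2 : ℕ)) := by decide
  rw [hmap, List.mem_map] at hw
  obtain ⟨e, he, rfl⟩ := hw
  exact ⟨e, he, key e he⟩

section Search

variable {X Y : SimpleGraph (Fin 7)} {enemy : ℕ}

lemma exists_reachable_of_descend (hX : ∀ e ∈ spiderEdges, X.Adj e.1 e.2)
    (hY : ∀ x y : Fin 7, enemy.testBit (8 * x + y) = false → Y.Adj x y) {bound d : ℕ}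
    {σ : Fin 7 ≃ Fin 7} (h : descend enemy bound d (code σ) = true) :
    ∃ φ, (FS X Y).Reachable σ φ ∧ code φ < bound := by
  induction d generalizing σ with
  | zero => exact ⟨σ, SimpleGraph.Reachable.refl _, by simpa [descend] using h⟩
  | succ d ih =>
    rw [descend, Bool.or_eq_true, List.any_eq_true] at h
    obtain h | ⟨w, hw, h⟩ := h
    · exact ⟨σ, SimpleGraph.Reachable.refl _, by simpa using h⟩
    · obtain ⟨e, he, hσ⟩ := code_swap hw
      obtain ⟨h₁, h₂, h₃⟩ := hσ σ
      simp only [forceNat_eq, h₁, h₂, h₃, Bool.and_eq_true, Bool.not_eq_true'] at h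
      obtain ⟨φ, hφ, hlt⟩ := ih h.2
      exact ⟨φ, (adj_swap (hX e he) (hY _ _ h.1)).reachable.trans hφ, hlt⟩

lemma connected_of_check (hX : ∀ e ∈ spiderEdges, X.Adj e.1 e.2)
    (hY : ∀ x y : Fin 7, enemy.testBit (8 * x + y) = false → Y.Adj x y)
    (h : check enemy = true) : (FS X Y).Connected := by
  have least : ∀ k σ, code σ = k → ∃ φ, (FS X Y).Reachable σ φ ∧ code φ = leastCode := by
    intro k
    induction k using Nat.strong_induction_on with
    | _ k ih =>
      rintro σ rfl
      obtain hσ | ⟨d, hd⟩ := check_apply h σ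
      · exact ⟨σ, SimpleGraph.Reachable.refl _, hσ⟩
      · obtain ⟨φ, hφ, hlt⟩ := exists_reachable_of_descend hX hY hd
        obtain ⟨ψ, hψ, hleast⟩ := ih _ hlt φ rfl
        exact ⟨ψ, hφ.trans hψ, hleast⟩
  have : Nonempty (Fin 7 ≃ Fin 7) := ⟨Equiv.refl _⟩
  refine SimpleGraph.Connected.mk fun σ τ => ?_
  obtain ⟨φ, hφ, hφ'⟩ := least _ σ rfl
  obtain ⟨ψ, hψ, hψ'⟩ := least _ τ rfl
  obtain rfl := code_injective (hφ'.trans hψ'.symm)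
  exact hφ.trans hψ.symm

end Search

/-- The permutation of `Fin 7` with the given values and inverse values. -/
abbrev permOfVec (f g : Fin 7 → Fin 7) (h : ∀ i, g (f i) = i) (h' : ∀ i, f (g i) = i) :
    Fin 7 ≃ Fin 7 := ⟨f, g, h, h'⟩

/-- An identification of the vertices of `spiderEdges` with those of `Spider 7 [2, 2, 1, 1]`. -/
def position : Fin 7 ≃ Fin 7 :=
  permOfVec ![5, 4, 6, 0, 2, 3, 1] ![3, 6, 4, 5, 1, 0, 2] (by decide) (by decide)

lemma connected_of_check_tadpole {c enemy : ℕ} (q : Fin 7 ≃ Fin 7)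
    (hq : ∀ x y : Fin 7, enemy.testBit (8 * x + y) = false →
      (q x : ℕ) ≠ q y ∧ (q y : ℕ) ≠ q x + 1 ∧ (q x : ℕ) ≠ q y + 1 ∧
      ¬((q x : ℕ) = 0 ∧ (q y : ℕ) = c - 1) ∧ ¬((q y : ℕ) = 0 ∧ (q x : ℕ) = c - 1))
    (h : check enemy = true) : (FS (Spider 7 [2, 2, 1, 1]) (Tadpole 7 c)ᶜ).Connected := by
  refine connected_of_equiv (X' := (Spider 7 [2, 2, 1, 1]).comap position)
    (Y' := (Tadpole 7 c)ᶜ.comap q) position q (fun _ _ => id) (fun _ _ => id)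
    (connected_of_check ?_ (fun x y hxy => Tadpole_compl_adj.2 (hq x y hxy)) h)
  simp only [SimpleGraph.comap_adj, Spider_adj]
  decide

lemma connected_seven {c : ℕ} (h3 : 3 ≤ c) (hc : c ≤ 7) :
    (FS (Spider 7 [2, 2, 1, 1]) (Tadpole 7 c)ᶜ).Connected := by
  interval_cases c
  · exact connected_of_check_tadpole (enemy := 20869908794266149)
      (permOfVec ![0, 5, 2, 3, 6, 1, 4] ![0, 5, 2, 3, 6, 1, 4] (by decide) (by decide))
      (by decide) (by decide +kernel)
  · exact connected_of_check_tadpole (enemy := 22565630063227429)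
      (permOfVec ![0, 4, 1, 2, 5, 3, 6] ![0, 2, 3, 5, 1, 4, 6] (by decide) (by decide))
      (by decide) (by decide +kernel)
  · exact connected_of_check_tadpole (enemy := 20590641397639777)
      (permOfVec ![0, 3, 5, 2, 6, 4, 1] ![0, 6, 3, 1, 5, 2, 4] (by decide) (by decide))
      (by decide) (by decide +kernel)
  · exact connected_of_check_tadpole (enemy := 19750618240672305)
      (permOfVec ![0, 4, 2, 6, 1, 5, 3] ![0, 4, 2, 6, 1, 5, 3] (by decide) (by decide))
      (by decide) (by decide +kernel)
  · exact connected_of_check_tadpole (enemy := 20589537624076881)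
      (permOfVec ![0, 2, 4, 5, 1, 3, 6] ![0, 4, 1, 5, 2, 3, 6] (by decide) (by decide))
      (by decide) (by decide +kernel)

lemma connected_spider_succ {n a b a' b' : ℕ} (hn : 6 ≤ n) {l m : Fin (n + 1)}
    (hlm : (Spider (n + 1) [a', b', 1, 1]).Adj l m)
    (hl : ∀ i j, (Spider n [a, b, 1, 1]).Adj i j →
      (Spider (n + 1) [a', b', 1, 1]).Adj (l.succAbove i) (l.succAbove j))
    (h : ∀ c, 3 ≤ c → c ≤ n → (FS (Spider n [a, b, 1, 1]) (Tadpole n c)ᶜ).Connected)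
    {c : ℕ} (h3 : 3 ≤ c) (hc : c ≤ n + 1) :
    (FS (Spider (n + 1) [a', b', 1, 1]) (Tadpole (n + 1) c)ᶜ).Connected := by
  refine connected_of_succAbove hlm hl (Tadpole_compl_connected (by omega)) fun v => ?_
  obtain ⟨c', h3', hc', hadj⟩ := Tadpole_compl_succAbove (by omega) h3 hc v
  exact ⟨_, hadj, h c' h3' hc'⟩

theorem connected_spider_tadpole {a b : ℕ} (ha : 2 ≤ a) (hb : 2 ≤ b) {n : ℕ}
    (hn : n = a + b + 3) {c : ℕ} (h3 : 3 ≤ c) (hc : c ≤ n) :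
    (FS (Spider n [a, b, 1, 1]) (Tadpole n c)ᶜ).Connected := by
  induction a, ha using Nat.le_induction generalizing n c with
  | base =>
    induction b, hb using Nat.le_induction generalizing n c with
    | base =>
      subst hn
      exact connected_seven h3 hc
    | succ b hb ih =>
      obtain rfl : n = 2 + b + 3 + 1 := by omega
      refine connected_spider_succ (by omega) (l := ⟨2 + b, by omega⟩)
        (m := ⟨2 + b - 1, by omega⟩) ?_
        (Spider_succAbove_second (by omega) rfl _ rfl)
        (fun c h3 hc => ih rfl h3 hc) h3 hc
      rw [Spider_adj]; dsimp only; omega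
  | succ a ha ih =>
    obtain rfl : n = a + b + 3 + 1 := by omega
    refine connected_spider_succ (by omega) (l := ⟨a, by omega⟩)
      (m := ⟨a - 1, by omega⟩) ?_
      (Spider_succAbove_first (by omega) (by omega) rfl _ rfl)
      (fun c h3 hc => ih rfl h3 hc) h3 hc
    rw [Spider_adj]; dsimp only; omega

end FS

/-- For `a ≥ b ≥ 2`, `n = a + b + 3` and any `3 ≤ c ≤ n`, the graph
`FS(Spider(a,b,1,1), complement of Tad_{c,n-c})` is connected. -/
theorem stmt7 (a b c : ℕ) (hb : 2 ≤ b) (hab : b ≤ a) (h3 : 3 ≤ c) (hc : c ≤ a + b + 3) :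
    (FS (Spider (a + b + 3) [a, b, 1, 1]) (Tadpole (a + b + 3) c)ᶜ).Connected :=
  FS.connected_spider_tadpole (hb.trans hab) hb rfl h3 hc
end

section
/- For every k ≥ 3, letting X = Spider(2,2,1,…,1) be the spider with k+1 legs (two legs of length 2 and k−1 legs of length 1) on n = k+4 vertices, the friends-and-strangers graph FS(X, complement of Spider(2,2,2,1,…,1)) is connected, where Spider(2,2,2,1,…,1) has k legs (three of length 2 and k−3 of length 1) on the same n vertices. -/
open SimpleGraph

/-! ### Adjacency in the two spiders -/

theorem legStart_nil (m : ℕ) : ¬ legStart [] m := by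
  rintro ⟨t, ht, hne, -⟩
  exact hne (List.prefix_nil.mp ht)

theorem legStart_cons (a : ℕ) (L : List ℕ) (m : ℕ) :
    legStart (a :: L) m ↔ m = 0 ∨ (a ≤ m ∧ legStart L (m - a)) := by
  constructor
  · rintro ⟨t, ht, hne, rfl⟩
    rcases List.prefix_cons_iff.mp ht with rfl | ⟨t, rfl, ht'⟩
    · simp
    · exact Or.inr ⟨by simp, t, ht', by rintro rfl; exact hne rfl, by simp⟩
  · rintro (rfl | ⟨ha, t, ht, hne, hs⟩)
    · exact ⟨[], by simp, by simp, by simp⟩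
    · exact ⟨a :: t, by simpa using ht, by simpa using hne, by rw [List.sum_cons]; omega⟩

theorem legStart_replicate_one (r m : ℕ) : legStart (List.replicate r 1) m ↔ m < r := by
  induction r generalizing m with
  | zero => simpa using legStart_nil m
  | succ r ih => rw [List.replicate_succ, legStart_cons, ih]; omega

/-- The spider with two legs of length 2 and `k - 1` legs of length 1. -/
abbrev spider22 (k : ℕ) : SimpleGraph (Fin (k + 4)) :=
  Spider (k + 4) ([2, 2] ++ List.replicate (k - 1) 1)

/-- The complement of the spider with three legs of length 2 and `k - 3` legs of length 1. -/
abbrev coSpider222 (k : ℕ) : SimpleGraph (Fin (k + 4)) :=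
  (Spider (k + 4) ([2, 2, 2] ++ List.replicate (k - 3) 1))ᶜ

theorem spider22_adj {k : ℕ} (hk : 3 ≤ k) (a b : Fin (k + 4)) :
    (spider22 k).Adj a b ↔
      ((b : ℕ) = k + 3 ∧ (a.val = 0 ∨ a.val = 2 ∨ (4 ≤ a.val ∧ a.val < k + 3)) ∨
        (b : ℕ) = a + 1 ∧ (a.val = 0 ∨ a.val = 2)) ∨
      ((a : ℕ) = k + 3 ∧ (b.val = 0 ∨ b.val = 2 ∨ (4 ≤ b.val ∧ b.val < k + 3)) ∨
        (a : ℕ) = b + 1 ∧ (b.val = 0 ∨ b.val = 2)) := by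
  simp only [spider22, Spider, SimpleGraph.fromRel_adj, List.cons_append, List.nil_append,
    legStart_cons, legStart_replicate_one, ne_eq, Fin.ext_iff]
  omega

theorem coSpider222_adj {k : ℕ} (hk : 3 ≤ k) (a b : Fin (k + 4)) :
    (coSpider222 k).Adj a b ↔ a ≠ b ∧
      ¬ ((b : ℕ) = k + 3 ∧ (a.val = 0 ∨ a.val = 2 ∨ a.val = 4 ∨ (6 ≤ a.val ∧ a.val < k + 3)) ∨
        (b : ℕ) = a + 1 ∧ (a.val = 0 ∨ a.val = 2 ∨ a.val = 4)) ∧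
      ¬ ((a : ℕ) = k + 3 ∧ (b.val = 0 ∨ b.val = 2 ∨ b.val = 4 ∨ (6 ≤ b.val ∧ b.val < k + 3)) ∨
        (a : ℕ) = b + 1 ∧ (b.val = 0 ∨ b.val = 2 ∨ b.val = 4)) := by
  simp only [coSpider222, Spider, SimpleGraph.compl_adj, SimpleGraph.fromRel_adj,
    List.cons_append, List.nil_append, legStart_cons, legStart_replicate_one, ne_eq, Fin.ext_iff]
  omega

/-! ### Moves and symmetries of friends-and-strangers graphs -/

theorem FS_reachable_swap {V W : Type*} [DecidableEq V] {X : SimpleGraph V} {Y : SimpleGraph W}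
    {a b : V} (σ : V ≃ W) (hX : X.Adj a b) (hY : Y.Adj (σ a) (σ b)) :
    (FS X Y).Reachable σ ((Equiv.swap a b).trans σ) := by
  refine SimpleGraph.Adj.reachable ?_
  rw [FS, SimpleGraph.fromRel_adj]
  refine ⟨fun h => hX.ne ?_, Or.inl ⟨a, b, hX, hY, rfl⟩⟩
  have := Equiv.congr_fun h b
  simpa using this.symm

theorem FS_reachable_trans_left {V W : Type*} [DecidableEq V] {X : SimpleGraph V}
    {Y : SimpleGraph W} (π : V ≃ V) (hπ : ∀ a b, X.Adj (π a) (π b) → X.Adj a b)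
    {σ τ : V ≃ W} (h : (FS X Y).Reachable σ τ) :
    (FS X Y).Reachable (π.trans σ) (π.trans τ) := by
  have key : ∀ σ τ : V ≃ W, (∃ a b : V, X.Adj a b ∧ Y.Adj (σ a) (σ b) ∧
      τ = (Equiv.swap a b).trans σ) → ∃ a b : V, X.Adj a b ∧
      Y.Adj (π.trans σ a) (π.trans σ b) ∧ π.trans τ = (Equiv.swap a b).trans (π.trans σ) := by
    rintro σ τ ⟨a, b, hX, hY, rfl⟩
    refine ⟨π.symm a, π.symm b, hπ _ _ (by simpa using hX), by simpa using hY, ?_⟩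
    ext v
    simp only [Equiv.trans_apply]
    rw [Equiv.swap_apply_def, Equiv.swap_apply_def]
    simp only [Equiv.eq_symm_apply]
    split_ifs <;> simp
  refine h.map (⟨fun σ => π.trans σ, ?_⟩ : FS X Y →g FS X Y)
  intro σ τ hadj
  rw [FS, SimpleGraph.fromRel_adj] at hadj ⊢
  refine ⟨fun h => hadj.1 ?_, hadj.2.imp (key _ _) (key _ _)⟩
  ext v
  simpa using Equiv.congr_fun h (π.symm v)

/-! ### Arrangements on seven vertices, encoded in octal -/

/-- The octal digit of `n` at place `i`. -/
def octDigit (n i : ℕ) : ℕ := n / 8 ^ i % 8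

/-- Exchange the octal digits of `n` at places `i` and `j`. -/
def octSwap (n i j : ℕ) : ℕ :=
  n ^^^ (octDigit n i ^^^ octDigit n j) * 8 ^ i ^^^ (octDigit n i ^^^ octDigit n j) * 8 ^ j

/-- The place in an octal code of the position `v`, one of `0, …, 5` or the center. -/
def octPlace (v : ℕ) : ℕ :=
  match v with
  | 0 => 4 | 1 => 6 | 2 => 3 | 3 => 5 | 4 => 0 | 5 => 2 | _ => 1

/-- The octal digit representing the person `v`, one of `0, …, 5` or the center. -/
def octPerson (v : ℕ) : ℕ :=
  match v with
  | 0 => 1 | 1 => 6 | 2 => 0 | 3 => 4 | 4 => 3 | 5 => 2 | _ => 5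

/-- Whether persons represented by `p` and `q` may be exchanged: the bytes of the mask are the
rows of the adjacency matrix of the complement of `Spider(2,2,2)`. -/
def octFriends (p q : ℕ) : Bool := Nat.testBit 17262806402538830 (8 * p + q)

/-- The edges of `Spider(2,2,1,1)`, as pairs of places. -/
def octEdges : List (ℕ × ℕ) := [(4, 6), (3, 5), (4, 1), (3, 1), (2, 1), (0, 1)]

/-- Whether an arrangement of code less than `N` can be reached from `n` in `fuel` moves. -/
def octDescends (N : ℕ) : ℕ → ℕ → Bool
  | 0, n => Nat.blt n N
  | fuel + 1, n => octEdges.any fun e =>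
      octFriends (octDigit n e.1) (octDigit n e.2) && octDescends N fuel (octSwap n e.1 e.2)

/-- The number with the given octal digits, most significant digit first. -/
def octCode (l : List ℕ) : ℕ := l.foldl (fun c x => 8 * c + x) 0

/-- Whether `n` is `42798`, that is, 0123456 in octal, or can be lowered in at most five moves. -/
def octImprovable (n : ℕ) : Bool :=
  Nat.beq n 42798 || [1, 2, 3, 4, 5].any fun fuel => octDescends n fuel n

theorem octImprovable_permutations :
    (List.range 7).permutations'.all (fun l => octImprovable (octCode l)) = true := by
  decide +kernel


theorem octDescends_or_eq {l : List ℕ} (hl : l.Perm (List.range 7)) :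
    octCode l = 42798 ∨ ∃ fuel, octDescends (octCode l) fuel (octCode l) = true := by
  have h := List.all_eq_true.mp octImprovable_permutations l (List.mem_permutations'.mpr hl)
  rw [octImprovable, Bool.or_eq_true, List.any_eq_true] at h
  exact h.imp Nat.eq_of_beq_eq_true fun ⟨f, _, hf⟩ => ⟨f, hf⟩

theorem octDigit_lt (n i : ℕ) : octDigit n i < 8 := Nat.mod_lt _ (by norm_num)

theorem octDigit_xor (m n i : ℕ) : octDigit (m ^^^ n) i = octDigit m i ^^^ octDigit n i := by
  have h : 8 ^ i = 2 ^ (3 * i) := by rw [pow_mul]; norm_num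
  rw [octDigit, octDigit, octDigit, h, ← Nat.shiftRight_eq_div_pow, ← Nat.shiftRight_eq_div_pow,
    ← Nat.shiftRight_eq_div_pow, Nat.shiftRight_xor_distrib]
  exact Nat.xor_mod_two_pow (n := 3)

theorem octDigit_mul_pow {x : ℕ} (hx : x < 8) (i t : ℕ) :
    octDigit (x * 8 ^ i) t = if t = i then x else 0 := by
  have h8 : ∀ m, 0 < 8 ^ m := fun m => by positivity
  rw [octDigit]
  rcases lt_trichotomy t i with h | rfl | h
  · obtain ⟨m, rfl⟩ := Nat.exists_eq_add_of_lt h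
    rw [if_neg h.ne, show x * 8 ^ (t + m + 1) = (x * 8 ^ m * 8) * 8 ^ t by ring,
      Nat.mul_div_cancel _ (h8 t), Nat.mul_mod_left]
  · rw [if_pos rfl, Nat.mul_div_cancel _ (h8 t), Nat.mod_eq_of_lt hx]
  · obtain ⟨m, rfl⟩ := Nat.exists_eq_add_of_lt h
    rw [if_neg h.ne', Nat.div_eq_of_lt, Nat.zero_mod]
    calc x * 8 ^ i < 8 * 8 ^ i := Nat.mul_lt_mul_of_pos_right hx (h8 i)
      _ = 8 ^ (i + 1) := by ring
      _ ≤ 8 ^ (i + m + 1) := Nat.pow_le_pow_right (by norm_num) (by omega)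

theorem octDigit_octSwap (n : ℕ) {i j : ℕ} (hij : i ≠ j) (t : ℕ) :
    octDigit (octSwap n i j) t =
      if t = i then octDigit n j else if t = j then octDigit n i else octDigit n t := by
  have hx : octDigit n i ^^^ octDigit n j < 8 :=
    Nat.xor_lt_two_pow (n := 3) (octDigit_lt n i) (octDigit_lt n j)
  rw [octSwap, octDigit_xor, octDigit_xor, octDigit_mul_pow hx, octDigit_mul_pow hx]
  split_ifs with hi hj hj
  · exact absurd (hi.symm.trans hj) hij
  · rw [hi, Nat.xor_zero, ← Nat.xor_assoc, Nat.xor_self, Nat.zero_xor]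
  · rw [hj, Nat.xor_zero, Nat.xor_comm (octDigit n i), ← Nat.xor_assoc, Nat.xor_self,
      Nat.zero_xor]
  · rw [Nat.xor_zero, Nat.xor_zero]

theorem eq_of_octDigit_eq {m n : ℕ} (hm : m < 8 ^ 7) (hn : n < 8 ^ 7)
    (h : ∀ i < 7, octDigit m i = octDigit n i) : m = n := by
  have h0 := h 0 (by norm_num)
  have h1 := h 1 (by norm_num)
  have h2 := h 2 (by norm_num)
  have h3 := h 3 (by norm_num)
  have h4 := h 4 (by norm_num)
  have h5 := h 5 (by norm_num)
  have h6 := h 6 (by norm_num)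
  norm_num [octDigit] at h0 h1 h2 h3 h4 h5 h6 hm hn
  omega

theorem octPlace_of_six_le {n : ℕ} (hn : 6 ≤ n) : octPlace n = 1 := by
  obtain ⟨m, rfl⟩ := Nat.exists_eq_add_of_le' hn
  rfl

theorem octPerson_of_six_le {n : ℕ} (hn : 6 ≤ n) : octPerson n = 5 := by
  obtain ⟨m, rfl⟩ := Nat.exists_eq_add_of_le' hn
  rfl

/-! ### Arrangements fixing all but some of the leaves -/

/-- The vertices `0, …, 5 + m` and the center. -/
def Active {k : ℕ} (m : ℕ) (v : Fin (k + 4)) : Prop := v.val < 6 + m ∨ v.val = k + 3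

/-- The arrangement `σ` moves active vertices only. -/
def FixesInactive {k : ℕ} (m : ℕ) (σ : Fin (k + 4) ≃ Fin (k + 4)) : Prop :=
  ∀ v, ¬ Active m v → σ v = v

theorem FixesInactive.swap {k m : ℕ} {σ : Fin (k + 4) ≃ Fin (k + 4)} (h : FixesInactive m σ)
    {a b : Fin (k + 4)} (ha : Active m a) (hb : Active m b) :
    FixesInactive m ((Equiv.swap a b).trans σ) := by
  intro v hv
  rw [Equiv.trans_apply, Equiv.swap_apply_of_ne_of_ne, h v hv]
  · rintro rfl; exact hv ha
  · rintro rfl; exact hv hb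

theorem FixesInactive.active_apply {k m : ℕ} {σ : Fin (k + 4) ≃ Fin (k + 4)}
    (h : FixesInactive m σ) {v : Fin (k + 4)} (hv : Active m v) : Active m (σ v) := by
  by_contra hσ
  exact hσ (by rwa [σ.injective (h _ hσ)])

theorem Active.val_cases {k : ℕ} {v : Fin (k + 4)} (h : Active 0 v) :
    v.val = 0 ∨ v.val = 1 ∨ v.val = 2 ∨ v.val = 3 ∨ v.val = 4 ∨ v.val = 5 ∨ v.val = k + 3 := by
  rw [Active] at h
  omega

theorem octPlace_injOn {k : ℕ} (hk : 3 ≤ k) {u v : Fin (k + 4)} (hu : Active 0 u)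
    (hv : Active 0 v) (h : octPlace u = octPlace v) : u = v := by
  have hc : octPlace (k + 3) = 1 := octPlace_of_six_le (by omega)
  rw [Fin.ext_iff]
  rcases hu.val_cases with e | e | e | e | e | e | e <;>
    rcases hv.val_cases with e' | e' | e' | e' | e' | e' | e' <;>
      rw [e, e'] at h ⊢ <;> (try rw [hc] at h) <;> exact absurd h (by decide)

theorem octPerson_injOn {k : ℕ} (hk : 3 ≤ k) {u v : Fin (k + 4)} (hu : Active 0 u)
    (hv : Active 0 v) (h : octPerson u = octPerson v) : u = v := by
  have hc : octPerson (k + 3) = 5 := octPerson_of_six_le (by omega)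
  rw [Fin.ext_iff]
  rcases hu.val_cases with e | e | e | e | e | e | e <;>
    rcases hv.val_cases with e' | e' | e' | e' | e' | e' | e' <;>
      rw [e, e'] at h ⊢ <;> (try rw [hc] at h) <;> exact absurd h (by decide)

theorem octPerson_lt (v : ℕ) : octPerson v < 7 := by
  unfold octPerson
  split <;> norm_num

theorem coSpider222_adj_of_octFriends {k : ℕ} (hk : 3 ≤ k) {p q : Fin (k + 4)}
    (hp : Active 0 p) (hq : Active 0 q) (h : octFriends (octPerson p) (octPerson q) = true) :
    (coSpider222 k).Adj p q := by
  have hc : octPerson (k + 3) = 5 := octPerson_of_six_le (by omega)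
  rw [coSpider222_adj hk, ne_eq, Fin.ext_iff]
  rcases hp.val_cases with e | e | e | e | e | e | e <;>
    rcases hq.val_cases with e' | e' | e' | e' | e' | e' | e' <;>
      rw [e, e'] at h ⊢ <;> (try simp only [hc] at h) <;>
        first | exact absurd h (by decide) | omega

theorem exists_spider22_adj_of_mem_octEdges {k : ℕ} (hk : 3 ≤ k) {e : ℕ × ℕ}
    (he : e ∈ octEdges) : ∃ a b : Fin (k + 4), Active 0 a ∧ Active 0 b ∧ octPlace a = e.1 ∧
      octPlace b = e.2 ∧ (spider22 k).Adj a b := by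
  have hc : octPlace (k + 3) = 1 := octPlace_of_six_le (by omega)
  simp only [octEdges, List.mem_cons, List.not_mem_nil, or_false] at he
  simp only [spider22_adj hk, Active]
  rcases he with rfl | rfl | rfl | rfl | rfl | rfl
  · exact ⟨⟨0, by omega⟩, ⟨1, by omega⟩, by simp [octPlace]⟩
  · exact ⟨⟨2, by omega⟩, ⟨3, by omega⟩, by simp [octPlace]⟩
  · exact ⟨⟨0, by omega⟩, ⟨k + 3, by omega⟩, by simp, by simp, rfl, hc, by simp⟩
  · exact ⟨⟨2, by omega⟩, ⟨k + 3, by omega⟩, by simp, by simp, rfl, hc, by simp⟩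
  · exact ⟨⟨5, by omega⟩, ⟨k + 3, by omega⟩, by simp, by simp, rfl, hc, by simp; omega⟩
  · exact ⟨⟨4, by omega⟩, ⟨k + 3, by omega⟩, by simp, by simp, rfl, hc, by simp; omega⟩

/-- The number `n` encodes the restriction of `σ` to the vertices `0, …, 5` and the center. -/
def Encodes {k : ℕ} (σ : Fin (k + 4) ≃ Fin (k + 4)) (n : ℕ) : Prop :=
  ∀ v, Active 0 v → octDigit n (octPlace v) = octPerson (σ v)

theorem Encodes.swap {k : ℕ} (hk : 3 ≤ k) {σ : Fin (k + 4) ≃ Fin (k + 4)} {n : ℕ}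
    (h : Encodes σ n) {a b : Fin (k + 4)} (ha : Active 0 a) (hb : Active 0 b) (hab : a ≠ b) :
    Encodes ((Equiv.swap a b).trans σ) (octSwap n (octPlace a) (octPlace b)) := by
  intro v hv
  rw [octDigit_octSwap n (fun e => hab (octPlace_injOn hk ha hb e)), Equiv.trans_apply,
    Equiv.swap_apply_def]
  simp only [fun u (hu : Active 0 u) =>
    (⟨octPlace_injOn hk hv hu, fun e => e ▸ rfl⟩ : octPlace v = octPlace u ↔ v = u), ha, hb]
  split_ifs
  · exact h b hb
  · exact h a ha
  · exact h v hv

theorem Encodes.exists_lt_of_octDescends {k : ℕ} (hk : 3 ≤ k) {N fuel n : ℕ}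
    {σ : Fin (k + 4) ≃ Fin (k + 4)} (hσ : FixesInactive 0 σ) (hn : Encodes σ n)
    (h : octDescends N fuel n = true) :
    ∃ τ n', (FS (spider22 k) (coSpider222 k)).Reachable σ τ ∧ FixesInactive 0 τ ∧
      Encodes τ n' ∧ n' < N := by
  induction fuel generalizing n σ with
  | zero => exact ⟨σ, n, .rfl, hσ, hn, by simpa [octDescends] using h⟩
  | succ fuel ih =>
    rw [octDescends, List.any_eq_true] at h
    obtain ⟨e, he, h⟩ := h
    rw [Bool.and_eq_true] at h
    obtain ⟨a, b, ha, hb, hea, heb, hab⟩ := exists_spider22_adj_of_mem_octEdges hk he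
    rw [← hea, ← heb, hn a ha, hn b hb] at h
    obtain ⟨τ, n', hτ, hrest⟩ := ih (hσ.swap ha hb) (hn.swap hk ha hb hab.ne) h.2
    exact ⟨τ, n', (FS_reachable_swap σ hab (coSpider222_adj_of_octFriends hk
      (hσ.active_apply ha) (hσ.active_apply hb) h.1)).trans hτ, hrest⟩

theorem FixesInactive.exists_encodes {k : ℕ} (hk : 3 ≤ k) {σ : Fin (k + 4) ≃ Fin (k + 4)}
    (hσ : FixesInactive 0 σ) :
    ∃ l : List ℕ, l.Perm (List.range 7) ∧ Encodes σ (octCode l) ∧ octCode l < 8 ^ 7 := by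
  have hc : octPlace (k + 3) = 1 := octPlace_of_six_le (by omega)
  let L : List (Fin (k + 4)) := [⟨1, by omega⟩, ⟨3, by omega⟩, ⟨0, by omega⟩, ⟨2, by omega⟩,
    ⟨5, by omega⟩, ⟨k + 3, by omega⟩, ⟨4, by omega⟩]
  have hL : ∀ v ∈ L, Active 0 v := by simp [L, Active]
  have hnodup : L.Nodup := by simp [L]; omega
  have hlt : ∀ v, octPerson (σ v) < 7 := fun v => octPerson_lt _
  refine ⟨L.map fun v => octPerson (σ v), ?_, ?_, ?_⟩
  · refine List.Subperm.perm_of_length_le (List.Nodup.subperm ?_ ?_) (by simp [L])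
    · refine hnodup.map_on fun u hu v hv e => σ.injective ?_
      exact octPerson_injOn hk (hσ.active_apply (hL u hu)) (hσ.active_apply (hL v hv)) e
    · intro x hx
      obtain ⟨v, -, rfl⟩ := List.mem_map.mp hx
      exact List.mem_range.mpr (hlt v)
  · intro v hv
    have h1 := hlt ⟨1, by omega⟩
    have h3 := hlt ⟨3, by omega⟩
    have h0 := hlt ⟨0, by omega⟩
    have h2 := hlt ⟨2, by omega⟩
    have h5 := hlt ⟨5, by omega⟩
    have hk3 := hlt ⟨k + 3, by omega⟩
    have h4 := hlt ⟨4, by omega⟩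
    obtain ⟨v, hvk⟩ := v
    rcases hv.val_cases with e | e | e | e | e | e | e <;> simp only at e <;> subst e <;>
      simp only [hc, L, octCode, octDigit, List.map, List.foldl] <;>
      (try simp only [octPlace]) <;> omega
  · have h1 := hlt ⟨1, by omega⟩
    have h3 := hlt ⟨3, by omega⟩
    have h0 := hlt ⟨0, by omega⟩
    have h2 := hlt ⟨2, by omega⟩
    have h5 := hlt ⟨5, by omega⟩
    have hk3 := hlt ⟨k + 3, by omega⟩
    have h4 := hlt ⟨4, by omega⟩
    simp only [L, octCode, List.map, List.foldl]
    omega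

theorem exists_octPlace_eq {k : ℕ} (hk : 3 ≤ k) {i : ℕ} (hi : i < 7) :
    ∃ v : Fin (k + 4), Active 0 v ∧ octPlace v = i := by
  have hc : octPlace (k + 3) = 1 := octPlace_of_six_le (by omega)
  interval_cases i
  · exact ⟨⟨4, by omega⟩, by simp [Active, octPlace]⟩
  · exact ⟨⟨k + 3, by omega⟩, by simp [Active, hc]⟩
  · exact ⟨⟨5, by omega⟩, by simp [Active, octPlace]⟩
  · exact ⟨⟨2, by omega⟩, by simp [Active, octPlace]⟩
  · exact ⟨⟨0, by omega⟩, by simp [Active, octPlace]⟩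
  · exact ⟨⟨3, by omega⟩, by simp [Active, octPlace]⟩
  · exact ⟨⟨1, by omega⟩, by simp [Active, octPlace]⟩

theorem FixesInactive.exists_reachable_encodes {k : ℕ} (hk : 3 ≤ k) {n : ℕ}
    {σ : Fin (k + 4) ≃ Fin (k + 4)} (hσ : FixesInactive 0 σ) (hn : Encodes σ n) (hn8 : n < 8 ^ 7) :
    ∃ τ, (FS (spider22 k) (coSpider222 k)).Reachable σ τ ∧ FixesInactive 0 τ ∧
      Encodes τ 42798 := by
  induction n using Nat.strong_induction_on generalizing σ with
  | _ n ih =>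
    obtain ⟨l, hl, hσl, hl8⟩ := hσ.exists_encodes hk
    obtain rfl : n = octCode l := by
      refine eq_of_octDigit_eq hn8 hl8 fun i hi => ?_
      obtain ⟨v, hv, rfl⟩ := exists_octPlace_eq hk hi
      rw [hn v hv, hσl v hv]
    rcases octDescends_or_eq hl with h | ⟨fuel, h⟩
    · exact ⟨σ, .rfl, hσ, h ▸ hσl⟩
    · obtain ⟨τ, n', hστ, hτ, hn', hlt⟩ := hσl.exists_lt_of_octDescends hk hσ h
      obtain ⟨ρ, hτρ, hρ⟩ := ih n' hlt hτ hn' (hlt.trans hl8)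
      exact ⟨ρ, hστ.trans hτρ, hρ⟩

theorem reachable_of_fixesInactive_zero {k : ℕ} (hk : 3 ≤ k) {σ τ : Fin (k + 4) ≃ Fin (k + 4)}
    (hσ : FixesInactive 0 σ) (hτ : FixesInactive 0 τ) :
    (FS (spider22 k) (coSpider222 k)).Reachable σ τ := by
  obtain ⟨l, -, hl, hl8⟩ := hσ.exists_encodes hk
  obtain ⟨l', -, hl', hl8'⟩ := hτ.exists_encodes hk
  obtain ⟨σ', hσ', hσf, hσe⟩ := hσ.exists_reachable_encodes hk hl hl8
  obtain ⟨τ', hτ', hτf, hτe⟩ := hτ.exists_reachable_encodes hk hl' hl8'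
  obtain rfl : σ' = τ' := by
    ext1 v
    by_cases hv : Active 0 v
    · exact octPerson_injOn hk (hσf.active_apply hv) (hτf.active_apply hv)
        ((hσe v hv).symm.trans (hτe v hv))
    · rw [hσf v hv, hτf v hv]
  exact hσ'.trans hτ'.symm

/-! ### Releasing one more leaf -/

theorem spider22_adj_of_swap_leaves {k : ℕ} (hk : 3 ≤ k) {u v : Fin (k + 4)}
    (hu : 4 ≤ u.val ∧ u.val < k + 3) (hv : 4 ≤ v.val ∧ v.val < k + 3) (a b : Fin (k + 4))
    (h : (spider22 k).Adj (Equiv.swap u v a) (Equiv.swap u v b)) : (spider22 k).Adj a b := by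
  rw [spider22_adj hk, Equiv.swap_apply_def, Equiv.swap_apply_def] at h
  rw [spider22_adj hk]
  simp only [Fin.ext_iff] at h
  split_ifs at h <;> omega

theorem reachable_of_fixesInactive_succ {k m : ℕ} (hk : 3 ≤ k) (hm : 6 + m < k + 3)
    (ih : ∀ σ τ : Fin (k + 4) ≃ Fin (k + 4), FixesInactive m σ → FixesInactive m τ →
      (FS (spider22 k) (coSpider222 k)).Reachable σ τ)
    {σ : Fin (k + 4) ≃ Fin (k + 4)} (hσ : FixesInactive (m + 1) σ) :
    (FS (spider22 k) (coSpider222 k)).Reachable σ (Equiv.refl _) := by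
  obtain ⟨c, hc⟩ : ∃ c : Fin (k + 4), c.val = k + 3 := ⟨⟨k + 3, by omega⟩, rfl⟩
  obtain ⟨l, hl⟩ : ∃ l : Fin (k + 4), l.val = 6 + m := ⟨⟨6 + m, by omega⟩, rfl⟩
  have hlc : l ≠ c := by rw [ne_eq, Fin.ext_iff]; omega
  have hc_act : Active (m + 1) c := Or.inr hc
  have hl_act : Active (m + 1) l := Or.inl (by omega)
  have l_friend : ∀ p, p ≠ c → p ≠ l → (coSpider222 k).Adj p l := by
    intro p hpc hpl
    rw [coSpider222_adj hk]
    rw [ne_eq, Fin.ext_iff] at *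
    omega
  have step : ∀ {σ : Fin (k + 4) ≃ Fin (k + 4)} {a b : Fin (k + 4)}, (spider22 k).Adj a b →
      (coSpider222 k).Adj (σ a) (σ b) → (FS (spider22 k) (coSpider222 k)).Reachable
        ((Equiv.swap a b).trans σ) (Equiv.refl _) →
      (FS (spider22 k) (coSpider222 k)).Reachable σ (Equiv.refl _) :=
    fun hX hY h => (FS_reachable_swap _ hX hY).trans h
  have at_self : ∀ σ : Fin (k + 4) ≃ Fin (k + 4), FixesInactive (m + 1) σ → σ l = l →
      FixesInactive m σ := by
    intro σ hσ h v hv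
    by_cases hvl : v = l
    · rw [hvl, h]
    · refine hσ v fun h' => ?_
      rw [Active] at hv h'
      rw [Fin.ext_iff] at hvl
      omega
  have at_leaf : ∀ (σ : Fin (k + 4) ≃ Fin (k + 4)) (u : Fin (k + 4)),
      FixesInactive (m + 1) σ → σ u = l → 4 ≤ u.val → u.val < k + 3 → Active (m + 1) u →
      (FS (spider22 k) (coSpider222 k)).Reachable σ (Equiv.refl _) := by
    intro σ u hσ hu hu4 hu3 hu_act
    by_cases hul : u = l
    · exact ih _ _ (at_self σ hσ (hul ▸ hu)) fun _ _ => rfl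
    obtain ⟨p, hp⟩ : ∃ p : Fin (k + 4), p.val = 1 := ⟨⟨1, by omega⟩, rfl⟩
    obtain ⟨q, hq⟩ : ∃ q : Fin (k + 4), q.val = 3 := ⟨⟨3, by omega⟩, rfl⟩
    have huc : u ≠ c := by rw [ne_eq, Fin.ext_iff]; omega
    have hpu : p ≠ u := by rw [ne_eq, Fin.ext_iff]; omega
    have hpq : p ≠ q := by rw [ne_eq, Fin.ext_iff]; omega
    have hpc : p ≠ c := by rw [ne_eq, Fin.ext_iff]; omega
    have hpl : p ≠ l := by rw [ne_eq, Fin.ext_iff]; omega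
    have hql : q ≠ l := by rw [ne_eq, Fin.ext_iff]; omega
    have hqc : q ≠ c := by rw [ne_eq, Fin.ext_iff]; omega
    have hp_act : Active (m + 1) p := Or.inl (by omega)
    have hq_act : Active (m + 1) q := Or.inl (by omega)
    obtain ⟨ρ, hρ, hρu, hρc, hρl⟩ : ∃ ρ : Fin (k + 4) ≃ Fin (k + 4),
        FixesInactive (m + 1) ρ ∧ ρ u = q ∧ ρ c = p ∧ ρ l = l := by
      refine ⟨(Equiv.swap c p).trans ((Equiv.swap u q).trans (Equiv.refl _)),
        FixesInactive.swap (FixesInactive.swap (fun _ _ => rfl) hu_act hq_act) hc_act hp_act,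
        ?_, ?_, ?_⟩
      · simp [Equiv.swap_apply_of_ne_of_ne huc hpu.symm]
      · simp [Equiv.swap_apply_of_ne_of_ne hpu hpq]
      · simp [Equiv.swap_apply_of_ne_of_ne hlc hpl.symm,
          Equiv.swap_apply_of_ne_of_ne (Ne.symm hul) hql.symm]
    have h := FS_reachable_trans_left (Equiv.swap u l)
      (spider22_adj_of_swap_leaves hk ⟨hu4, hu3⟩ ⟨by omega, by omega⟩)
      (ih _ _ (at_self _ (hσ.swap hu_act hl_act) (by simpa using hu)) (at_self ρ hρ hρl))
    rw [← Equiv.trans_assoc, Equiv.swap_swap, Equiv.refl_trans] at h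
    refine h.trans (step (a := u) (b := c) ?_ ?_ (step (a := l) (b := c) ?_ ?_
      (ih _ _ (at_self _ (((hρ.swap hu_act hl_act).swap hu_act hc_act).swap hl_act hc_act) ?_)
        fun _ _ => rfl)))
    · rw [spider22_adj hk]; omega
    · simpa [Equiv.swap_apply_of_ne_of_ne huc.symm hlc.symm, hρc, hρl]
        using (l_friend p hpc hpl).symm
    · rw [spider22_adj hk]; omega
    · simpa [Equiv.swap_apply_of_ne_of_ne (Ne.symm hul) hlc, hρu, hρl] using l_friend q hqc hql
    · simp [hρl]
  have at_center : ∀ σ : Fin (k + 4) ≃ Fin (k + 4), FixesInactive (m + 1) σ → σ c = l →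
      (FS (spider22 k) (coSpider222 k)).Reachable σ (Equiv.refl _) := by
    intro σ hσ h
    obtain ⟨u, hu, hσu⟩ : ∃ u : Fin (k + 4), (u.val = 4 ∨ u.val = 5) ∧ σ u ≠ c := by
      by_cases h4 : σ ⟨4, by omega⟩ = c
      · refine ⟨⟨5, by omega⟩, Or.inr rfl, fun h5 => ?_⟩
        simpa using σ.injective (h4.trans h5.symm)
      · exact ⟨_, Or.inl rfl, h4⟩
    have hu_act : Active (m + 1) u := Or.inl (by omega)
    have huc : u ≠ c := by rw [ne_eq, Fin.ext_iff]; omega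
    refine step (a := u) (b := c) ?_ ?_ (at_leaf _ u (hσ.swap hu_act hc_act) (by simpa using h)
      (by omega) (by omega) hu_act)
    · rw [spider22_adj hk]; omega
    · rw [h]
      exact l_friend _ hσu fun e => huc (σ.injective (e.trans h.symm))
  have at_mid_of_ne : ∀ (σ : Fin (k + 4) ≃ Fin (k + 4)) (a : Fin (k + 4)),
      FixesInactive (m + 1) σ → (a.val = 0 ∨ a.val = 2) → σ a = l → σ c ≠ c →
      (FS (spider22 k) (coSpider222 k)).Reachable σ (Equiv.refl _) := by
    intro σ a hσ ha h hσc
    have hac : a ≠ c := by rw [ne_eq, Fin.ext_iff]; omega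
    refine step (a := a) (b := c) ?_ ?_
      (at_center _ (hσ.swap (Or.inl (by omega)) hc_act) (by simpa using h))
    · rw [spider22_adj hk]; omega
    · rw [h]
      exact (l_friend _ hσc fun e => hac (σ.injective (h.trans e.symm))).symm
  -- The friends of the center are three, and two of them at most sit at the ends of the legs.
  have friends : ∀ (σ : Fin (k + 4) ≃ Fin (k + 4)), ∃ p₁ p₃ p₅ : Fin (k + 4),
      (σ p₁).val = 1 ∧ (σ p₃).val = 3 ∧ (σ p₅).val = 5 ∧
      p₁.val ≠ p₃.val ∧ p₁.val ≠ p₅.val ∧ p₃.val ≠ p₅.val := by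
    intro σ
    refine ⟨σ.symm ⟨1, by omega⟩, σ.symm ⟨3, by omega⟩, σ.symm ⟨5, by omega⟩, ?_⟩
    simp [← Fin.ext_iff]
  have active_of_friend : ∀ (σ : Fin (k + 4) ≃ Fin (k + 4)) (p : Fin (k + 4)),
      FixesInactive (m + 1) σ → ((σ p).val = 1 ∨ (σ p).val = 3 ∨ (σ p).val = 5) →
      Active (m + 1) p := by
    intro σ p hσ hp
    by_contra h
    rw [hσ p h] at hp
    exact h (Or.inl (by omega))
  have at_mid : ∀ (σ : Fin (k + 4) ≃ Fin (k + 4)) (a : Fin (k + 4)),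
      FixesInactive (m + 1) σ → (a.val = 0 ∨ a.val = 2) → σ a = l →
      (FS (spider22 k) (coSpider222 k)).Reachable σ (Equiv.refl _) := by
    intro σ a hσ ha h
    by_cases hσc : σ c = c
    swap
    · exact at_mid_of_ne σ a hσ ha h hσc
    have hac : a ≠ c := by rw [ne_eq, Fin.ext_iff]; omega
    obtain ⟨p, hp, hp1, hp3⟩ : ∃ p : Fin (k + 4),
        ((σ p).val = 1 ∨ (σ p).val = 3 ∨ (σ p).val = 5) ∧ p.val ≠ 1 ∧ p.val ≠ 3 := by
      obtain ⟨p₁, p₃, p₅, h1, h3, h5, h13, h15, h35⟩ := friends σ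
      by_cases g1 : p₁.val ≠ 1 ∧ p₁.val ≠ 3
      · exact ⟨p₁, by omega, g1⟩
      by_cases g3 : p₃.val ≠ 1 ∧ p₃.val ≠ 3
      · exact ⟨p₃, by omega, g3⟩
      · exact ⟨p₅, by omega, by omega⟩
    have hpc : p ≠ c := by rintro rfl; rw [hσc] at hp; omega
    have hap : a ≠ p := by rintro rfl; rw [h] at hp; omega
    refine step (a := p) (b := c) ?_ ?_ (at_mid_of_ne _ a
      (hσ.swap (active_of_friend σ p hσ hp) hc_act) ha ?_ ?_)
    · rw [ne_eq, Fin.ext_iff] at hpc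
      rw [spider22_adj hk]; omega
    · rw [hσc, coSpider222_adj hk, ne_eq, Fin.ext_iff]; omega
    · simpa [Equiv.swap_apply_of_ne_of_ne hap hac] using h
    · intro e
      rw [Equiv.trans_apply, Equiv.swap_apply_right] at e
      rw [e] at hp; omega
  have at_end_of_ne : ∀ (σ : Fin (k + 4) ≃ Fin (k + 4)) (a e : Fin (k + 4)),
      FixesInactive (m + 1) σ → (a.val = 0 ∨ a.val = 2) → e.val = a.val + 1 → σ e = l →
      σ a ≠ c → (FS (spider22 k) (coSpider222 k)).Reachable σ (Equiv.refl _) := by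
    intro σ a e hσ ha he h hσa
    have hae : a ≠ e := by rw [ne_eq, Fin.ext_iff]; omega
    refine step (a := a) (b := e) ?_ ?_ (at_mid _ a
      (hσ.swap (Or.inl (by omega)) (Or.inl (by omega))) ha (by simpa using h))
    · rw [spider22_adj hk]; omega
    · rw [h]
      exact l_friend _ hσa fun e' => hae (σ.injective (e'.trans h.symm))
  have at_end_of_friend : ∀ (σ : Fin (k + 4) ≃ Fin (k + 4)) (a e : Fin (k + 4)),
      FixesInactive (m + 1) σ → (a.val = 0 ∨ a.val = 2) → e.val = a.val + 1 → σ e = l →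
      σ a = c → ((σ c).val = 1 ∨ (σ c).val = 3 ∨ (σ c).val = 5) →
      (FS (spider22 k) (coSpider222 k)).Reachable σ (Equiv.refl _) := by
    intro σ a e hσ ha he h hσa hσc
    have hea : e ≠ a := by rw [ne_eq, Fin.ext_iff]; omega
    have hec : e ≠ c := by rw [ne_eq, Fin.ext_iff]; omega
    refine step (a := a) (b := c) ?_ ?_ (at_end_of_ne _ a e
      (hσ.swap (Or.inl (by omega)) hc_act) ha he ?_ ?_)
    · rw [spider22_adj hk]; omega
    · rw [hσa, coSpider222_adj hk, ne_eq, Fin.ext_iff]; omega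
    · simpa [Equiv.swap_apply_of_ne_of_ne hea hec] using h
    · intro e'
      rw [Equiv.trans_apply, Equiv.swap_apply_left] at e'
      rw [e'] at hσc; omega
  have at_end : ∀ (σ : Fin (k + 4) ≃ Fin (k + 4)) (a e : Fin (k + 4)),
      FixesInactive (m + 1) σ → (a.val = 0 ∨ a.val = 2) → e.val = a.val + 1 → σ e = l →
      (FS (spider22 k) (coSpider222 k)).Reachable σ (Equiv.refl _) := by
    intro σ a e hσ ha he h
    by_cases hσa : σ a = c
    swap
    · exact at_end_of_ne σ a e hσ ha he h hσa
    by_cases hσc : (σ c).val = 1 ∨ (σ c).val = 3 ∨ (σ c).val = 5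
    · exact at_end_of_friend σ a e hσ ha he h hσa hσc
    have hac : a ≠ c := by rw [ne_eq, Fin.ext_iff]; omega
    have hec : e ≠ c := by rw [ne_eq, Fin.ext_iff]; omega
    have hcc : (σ c).val ≠ k + 3 := by
      intro h'
      exact hac (σ.injective (hσa.trans (Fin.ext (hc.trans h'.symm))))
    have not_end : ∀ p : Fin (k + 4), (σ p).val = 1 ∨ (σ p).val = 3 ∨ (σ p).val = 5 →
        p.val ≠ e.val := by
      intro p hp hpe
      rw [Fin.ext hpe, h] at hp
      omega
    obtain ⟨p, hp, hp1, hp3, hpσ⟩ : ∃ p : Fin (k + 4),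
        ((σ p).val = 1 ∨ (σ p).val = 3 ∨ (σ p).val = 5) ∧ p.val ≠ 1 ∧ p.val ≠ 3 ∧
          (σ p).val ≠ (σ c).val + 1 := by
      obtain ⟨p₁, p₃, p₅, h1, h3, h5, h13, h15, h35⟩ := friends σ
      have e1 := not_end p₁ (by omega)
      have e3 := not_end p₃ (by omega)
      have e5 := not_end p₅ (by omega)
      by_cases g1 : p₁.val ≠ 1 ∧ p₁.val ≠ 3 ∧ (σ p₁).val ≠ (σ c).val + 1
      · exact ⟨p₁, by omega, g1⟩
      by_cases g3 : p₃.val ≠ 1 ∧ p₃.val ≠ 3 ∧ (σ p₃).val ≠ (σ c).val + 1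
      · exact ⟨p₃, by omega, g3⟩
      · exact ⟨p₅, by omega, by omega⟩
    have hpc : p ≠ c := by rintro rfl; exact hσc hp
    have hap : a ≠ p := by rintro rfl; rw [hσa] at hp; omega
    have hep : e ≠ p := by rintro rfl; rw [h] at hp; omega
    refine step (a := p) (b := c) ?_ ?_ (at_end_of_friend _ a e
      (hσ.swap (active_of_friend σ p hσ hp) hc_act) ha he ?_ ?_ (by simpa using hp))
    · rw [ne_eq, Fin.ext_iff] at hpc
      rw [spider22_adj hk]; omega
    · rw [coSpider222_adj hk, ne_eq, Fin.ext_iff]; omega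
    · simpa [Equiv.swap_apply_of_ne_of_ne hep hec] using h
    · simpa [Equiv.swap_apply_of_ne_of_ne hap hac] using hσa
  obtain ⟨u, hu⟩ := σ.surjective l
  have hu_act : Active (m + 1) u := by
    by_contra h
    exact h (by rwa [← hσ u h, hu])
  have hu4 := u.isLt
  rcases (by omega : (u.val = 0 ∨ u.val = 2) ∨ u.val = 1 ∨ u.val = 3 ∨
      (4 ≤ u.val ∧ u.val < k + 3) ∨ u.val = k + 3) with h | h | h | h | h
  · exact at_mid σ u hσ h hu
  · exact at_end σ ⟨0, by omega⟩ u hσ (Or.inl rfl) h hu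
  · exact at_end σ ⟨2, by omega⟩ u hσ (Or.inr rfl) h hu
  · exact at_leaf σ u hσ hu h.1 h.2 hu_act
  · exact at_center σ hσ (by rwa [← Fin.ext (h.trans hc.symm)])

theorem reachable_of_fixesInactive {k m : ℕ} (hk : 3 ≤ k) (hm : 6 + m ≤ k + 3)
    (σ τ : Fin (k + 4) ≃ Fin (k + 4)) (hσ : FixesInactive m σ) (hτ : FixesInactive m τ) :
    (FS (spider22 k) (coSpider222 k)).Reachable σ τ := by
  induction m generalizing σ τ with
  | zero => exact reachable_of_fixesInactive_zero hk hσ hτ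
  | succ m ih =>
    have ih' := ih (by omega)
    exact (reachable_of_fixesInactive_succ hk (by omega) ih' hσ).trans
      (reachable_of_fixesInactive_succ hk (by omega) ih' hτ).symm

/-- For `k ≥ 3`, `FS(Spider(2,2,1,…,1), complement of Spider(2,2,2,1,…,1))` is connected,
where the first spider has `k+1` legs and the second has `k` legs, on `n = k+4` vertices. -/
theorem stmt8 (k : ℕ) (hk : 3 ≤ k) :
    (FS (Spider (k + 4) ([2, 2] ++ List.replicate (k - 1) 1))
        (Spider (k + 4) ([2, 2, 2] ++ List.replicate (k - 3) 1))ᶜ).Connected := by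
  have h : ∀ σ : Fin (k + 4) ≃ Fin (k + 4), FixesInactive (k - 3) σ := by
    intro σ v hv
    exact absurd (by rw [Active]; omega) hv
  exact ⟨fun σ τ => reachable_of_fixesInactive hk (by omega) σ τ (h σ) (h τ)⟩
end
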